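/- Let f = h + conj(g) be a harmonic K-quasiregular mapping in the unit disk 𝔻 with u = Re f and v = Im f, and suppose there is a real constant C such that u(z) ≥ C for all z ∈ 𝔻 and v(0) = 0. If u belongs to the class h·log⁺h, then f ∈ h¹. -/

import Mathlib

open Complex Real Set

noncomputable section

/-- The open unit disk in the complex plane. -/
def unitDisk : Set ℂ := Metric.ball 0 1

/-- The integral mean `M_p(r, f)` of a complex-valued function `f`. -/
def circleMean (p : ℝ) (f : ℂ → ℂ) (r : ℝ) : ℝ :=
  ((1 / (2 * π)) *
    ∫ θ in (0:ℝ)..(2 * π), ‖f (r * Complex.exp (θ * Complex.I))‖ ^ p) ^ (1 / p)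

/-- Membership in the (harmonic/analytic) Hardy space of exponent `p`. -/
def InHardy (p : ℝ) (f : ℂ → ℂ) : Prop :=
  ∃ C : ℝ, ∀ r : ℝ, 0 < r → r < 1 → circleMean p f r ≤ C

/-- `log⁺ x = max (log x) 0`. -/
def logPlus (x : ℝ) : ℝ := max (Real.log x) 0

/-- The integral `∫₀^{2π} |u(re^{iθ})| log⁺|u(re^{iθ})| dθ`. -/
def zygmundIntegral (u : ℂ → ℝ) (r : ℝ) : ℝ :=
  ∫ θ in (0:ℝ)..(2 * π),
    |u (r * Complex.exp (θ * Complex.I))| * logPlus |u (r * Complex.exp (θ * Complex.I))|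

/-- The class `h·log⁺h`: real-valued harmonic functions with uniformly bounded
`∫ |u| log⁺|u|` integrals. -/
def InZygmundClass (u : ℂ → ℝ) : Prop :=
  ∃ C : ℝ, ∀ r : ℝ, 0 < r → r < 1 → zygmundIntegral u r ≤ C

/-- If `P` has continuous partial derivative `P'` in its first variable, then the integral of `P`
over the second variable may be differentiated under the integral sign. -/
theorem hasDerivAt_integral_of_continuousOn {P P' : ℝ → ℝ → ℝ} {T : ℝ} (hT : 0 ≤ T)
    (hP : ∀ s < 0, Continuous (P s)) (hP' : ContinuousOn (fun p : ℝ × ℝ => P' p.1 p.2) {p | p.1 < 0})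
    (hd : ∀ s < 0, ∀ θ, HasDerivAt (fun x => P x θ) (P' s θ) s) {s : ℝ} (hs : s < 0) :
    HasDerivAt (fun x => ∫ θ in (0 : ℝ)..T, P x θ) (∫ θ in (0 : ℝ)..T, P' s θ) s := by
  have hcomp : IsCompact (Icc (2 * s) (s / 2) ×ˢ Icc 0 T) := isCompact_Icc.prod isCompact_Icc
  obtain ⟨B, hB⟩ := hcomp.exists_bound_of_continuousOn
    (hP'.mono fun p hp => show p.1 < 0 by linarith [hp.1.2])
  have hP's : Continuous (P' s) := by
    rw [continuous_iff_continuousAt]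
    intro θ
    have h1 : ContinuousAt (fun p : ℝ × ℝ => P' p.1 p.2) (s, θ) :=
      hP'.continuousAt ((isOpen_lt continuous_fst continuous_const).mem_nhds hs)
    exact ContinuousAt.comp (f := fun t : ℝ => (s, t)) h1 (by fun_prop)
  refine (intervalIntegral.hasDerivAt_integral_of_dominated_loc_of_deriv_le
    (bound := fun _ => B) (Icc_mem_nhds (by linarith : 2 * s < s) (by linarith : s < s / 2))
    ?_ ((hP s hs).intervalIntegrable _ _) hP's.aestronglyMeasurable ?_ ?_ ?_).2
  · filter_upwards [gt_mem_nhds hs] with x hx using (hP x hx).aestronglyMeasurable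
  · refine Filter.Eventually.of_forall fun θ hθ x hx => hB (x, θ) ⟨hx, ?_⟩
    rw [uIoc_of_le hT] at hθ
    exact ⟨hθ.1.le, hθ.2⟩
  · exact intervalIntegrable_const
  · exact Filter.Eventually.of_forall fun θ hθ x hx => hd x (by linarith [hx.2]) θ

/-- The function `A x log x - √(x² + y²)`. -/
def zygmundAux (A x y : ℝ) : ℝ := A * (x * Real.log x) - √(x ^ 2 + y ^ 2)

/-- First derivative of `zygmundAux` along a curve with velocity `(x₁, y₁)`. -/
def zygmundAuxDeriv (A x x₁ y y₁ : ℝ) : ℝ :=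
  A * (x₁ * (Real.log x + 1)) - (x * x₁ + y * y₁) / √(x ^ 2 + y ^ 2)

/-- Second derivative of `zygmundAux` along a curve with velocity `(x₁, y₁)` and acceleration
`(x₂, y₂)`. -/
def zygmundAuxDeriv₂ (A x x₁ x₂ y y₁ y₂ : ℝ) : ℝ :=
  A * (x₂ * (Real.log x + 1) + x₁ ^ 2 / x)
    - ((x₁ ^ 2 + y₁ ^ 2 + x * x₂ + y * y₂) / √(x ^ 2 + y ^ 2)
      - (x * x₁ + y * y₁) ^ 2 / √(x ^ 2 + y ^ 2) ^ 3)

theorem hasDerivAt_zygmundAux {A t x₁ y₁ : ℝ} {x y : ℝ → ℝ} (hx : HasDerivAt x x₁ t)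
    (hy : HasDerivAt y y₁ t) (h0 : 0 < x t) :
    HasDerivAt (fun t => zygmundAux A (x t) (y t)) (zygmundAuxDeriv A (x t) x₁ (y t) y₁) t := by
  have hR : 0 < x t ^ 2 + y t ^ 2 := by positivity
  have hR' := Real.sqrt_pos.2 hR
  have := ((hx.mul (hx.log h0.ne')).const_mul A).sub
    (((hx.pow 2).add (hy.pow 2)).sqrt hR.ne')
  refine this.congr_deriv ?_
  unfold zygmundAuxDeriv
  simp only [Pi.add_apply, Pi.pow_apply]
  field_simp
  ring

theorem hasDerivAt_zygmundAuxDeriv {A t x₂ y₂ : ℝ} {x y x₁ y₁ : ℝ → ℝ}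
    (hx : HasDerivAt x (x₁ t) t) (hy : HasDerivAt y (y₁ t) t) (hx₁ : HasDerivAt x₁ x₂ t)
    (hy₁ : HasDerivAt y₁ y₂ t) (h0 : 0 < x t) :
    HasDerivAt (fun t => zygmundAuxDeriv A (x t) (x₁ t) (y t) (y₁ t))
      (zygmundAuxDeriv₂ A (x t) (x₁ t) x₂ (y t) (y₁ t) y₂) t := by
  have hR : 0 < x t ^ 2 + y t ^ 2 := by positivity
  have hR' := Real.sqrt_pos.2 hR
  have := ((hx₁.mul ((hx.log h0.ne').add_const 1)).const_mul A).sub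
    (((hx.mul hx₁).add (hy.mul hy₁)).div (((hx.pow 2).add (hy.pow 2)).sqrt hR.ne') hR'.ne')
  refine this.congr_deriv ?_
  unfold zygmundAuxDeriv₂
  simp only [Pi.add_apply, Pi.pow_apply, Pi.mul_apply]
  field_simp
  ring

/-- The sum of second derivatives of `zygmundAux` along conjugate directions is nonnegative. -/
theorem zygmundAuxDeriv₂_add_nonneg {K x y a b c d x₂ y₂ : ℝ} (hx : 0 < x)
    (h : c ^ 2 + d ^ 2 ≤ K ^ 2 * (a ^ 2 + b ^ 2)) :
    0 ≤ zygmundAuxDeriv₂ (1 + K ^ 2) x a x₂ y d y₂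
      + zygmundAuxDeriv₂ (1 + K ^ 2) x (-b) (-x₂) y c (-y₂) := by
  have hR : 0 < √(x ^ 2 + y ^ 2) := Real.sqrt_pos.2 (by positivity)
  have hxR : x ≤ √(x ^ 2 + y ^ 2) := Real.le_sqrt_of_sq_le (by nlinarith [sq_nonneg y])
  unfold zygmundAuxDeriv₂
  set R := √(x ^ 2 + y ^ 2)
  have key : (a ^ 2 + b ^ 2 + c ^ 2 + d ^ 2) / R ≤ (1 + K ^ 2) * (a ^ 2 + b ^ 2) / x := by
    apply div_le_div₀ (by positivity) (by linarith) hx hxR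
  have h1 : 0 ≤ (x * a + y * d) ^ 2 / R ^ 3 := by positivity
  have h2 : 0 ≤ (x * (-b) + y * c) ^ 2 / R ^ 3 := by positivity
  have : (1 + K ^ 2) * (x₂ * (Real.log x + 1) + a ^ 2 / x)
      - ((a ^ 2 + d ^ 2 + x * x₂ + y * y₂) / R - (x * a + y * d) ^ 2 / R ^ 3)
      + ((1 + K ^ 2) * (-x₂ * (Real.log x + 1) + (-b) ^ 2 / x)
      - (((-b) ^ 2 + c ^ 2 + x * -x₂ + y * -y₂) / R - (x * (-b) + y * c) ^ 2 / R ^ 3))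
      = ((1 + K ^ 2) * (a ^ 2 + b ^ 2) / x - (a ^ 2 + b ^ 2 + c ^ 2 + d ^ 2) / R)
        + (x * a + y * d) ^ 2 / R ^ 3 + (x * (-b) + y * c) ^ 2 / R ^ 3 := by ring
  rw [this]
  linarith

/-- Integral of the auxiliary function over a vertical period stays bounded below as one moves
towards the boundary of the left half plane, because it is convex. -/
theorem exists_le_integral_zygmundAux {K : ℝ} {H G : ℂ → ℂ}
    (hH : DifferentiableOn ℂ H {w | w.re < 0}) (hG : DifferentiableOn ℂ G {w | w.re < 0})
    (hHper : ∀ w, H (w + 2 * π * I) = H w) (hGper : ∀ w, G (w + 2 * π * I) = G w)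
    (hH0 : ∀ w, w.re < 0 → 0 < (H w).re)
    (hGH : ∀ w, w.re < 0 → ‖deriv G w‖ ≤ K * ‖deriv H w‖) :
    ∃ B : ℝ, ∀ s : ℝ, -1 ≤ s → s < 0 →
      B ≤ ∫ θ in (0 : ℝ)..2 * π,
        zygmundAux (1 + K ^ 2) (H (s + θ * I)).re (G (s + θ * I)).im := by
  have hopen : IsOpen {w : ℂ | w.re < 0} := isOpen_lt Complex.continuous_re continuous_const
  have hH1 := hH.deriv hopen
  have hG1 := hG.deriv hopen
  have hH2 := hH1.deriv hopen
  have hG2 := hG1.deriv hopen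
  have dat {E : ℂ → ℂ} (hE : DifferentiableOn ℂ E {w | w.re < 0}) (s θ : ℝ) (hs : s < 0) :
      HasDerivAt E (deriv E (s + θ * I)) (s + θ * I) :=
    (hE.differentiableAt (hopen.mem_nhds (by simpa using hs))).hasDerivAt
  have horiz {E : ℂ → ℂ} (hE : DifferentiableOn ℂ E {w | w.re < 0}) (s θ : ℝ) (hs : s < 0) :
      HasDerivAt (fun x : ℝ => E (x + θ * I)) (deriv E (s + θ * I)) s := by
    have := (dat hE s θ hs).comp s ((HasDerivAt.ofReal_comp (hasDerivAt_id s)).add_const (θ * I))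
    simpa [Function.comp_def] using this
  have vert {E : ℂ → ℂ} (hE : DifferentiableOn ℂ E {w | w.re < 0}) (s θ : ℝ) (hs : s < 0) :
      HasDerivAt (fun x : ℝ => E (s + x * I)) (deriv E (s + θ * I) * I) θ := by
    have := (dat hE s θ hs).comp θ
      (((HasDerivAt.ofReal_comp (hasDerivAt_id θ)).mul_const I).const_add (s : ℂ))
    simpa [Function.comp_def] using this
  have cre {e : ℝ → ℂ} {e' : ℂ} {t : ℝ} (h : HasDerivAt e e' t) :
      HasDerivAt (fun t => (e t).re) e'.re t :=
    Complex.reCLM.hasFDerivAt.comp_hasDerivAt t h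
  have cim {e : ℝ → ℂ} {e' : ℂ} {t : ℝ} (h : HasDerivAt e e' t) :
      HasDerivAt (fun t => (e t).im) e'.im t :=
    Complex.imCLM.hasFDerivAt.comp_hasDerivAt t h
  have cont {E : ℂ → ℂ} (hE : DifferentiableOn ℂ E {w | w.re < 0}) :
      ContinuousOn (fun p : ℝ × ℝ => E (p.1 + p.2 * I)) {p | p.1 < 0} :=
    hE.continuousOn.comp (by fun_prop) fun p hp => by simpa using hp
  have contre {E : ℂ → ℂ} (hE : DifferentiableOn ℂ E {w | w.re < 0}) :
      ContinuousOn (fun p : ℝ × ℝ => (E (p.1 + p.2 * I)).re) {p | p.1 < 0} :=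
    Complex.continuous_re.comp_continuousOn (cont hE)
  have contim {E : ℂ → ℂ} (hE : DifferentiableOn ℂ E {w | w.re < 0}) :
      ContinuousOn (fun p : ℝ × ℝ => (E (p.1 + p.2 * I)).im) {p | p.1 < 0} :=
    Complex.continuous_im.comp_continuousOn (cont hE)
  have slice {P : ℝ → ℝ → ℝ} (hP : ContinuousOn (fun p : ℝ × ℝ => P p.1 p.2) {p | p.1 < 0})
      (s : ℝ) (hs : s < 0) : Continuous (P s) :=
    hP.comp_continuous (f := fun t : ℝ => (s, t)) (by fun_prop) fun _ => hs
  have hx0 (p : ℝ × ℝ) (hp : p ∈ {p : ℝ × ℝ | p.1 < 0}) : (H (p.1 + p.2 * I)).re ≠ 0 :=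
    (hH0 _ (by simpa using hp)).ne'
  have hlog : ContinuousOn (fun p : ℝ × ℝ => Real.log (H (p.1 + p.2 * I)).re) {p | p.1 < 0} :=
    (contre hH).log hx0
  have hsq : ContinuousOn (fun p : ℝ × ℝ =>
      √((H (p.1 + p.2 * I)).re ^ 2 + (G (p.1 + p.2 * I)).im ^ 2)) {p | p.1 < 0} :=
    (((contre hH).pow 2).add ((contim hG).pow 2)).sqrt
  have hsq0 (p : ℝ × ℝ) (hp : p ∈ {p : ℝ × ℝ | p.1 < 0}) :
      √((H (p.1 + p.2 * I)).re ^ 2 + (G (p.1 + p.2 * I)).im ^ 2) ≠ 0 := by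
    have := hx0 p hp
    positivity
  let A := 1 + K ^ 2
  let P : ℝ → ℝ → ℝ := fun s θ => zygmundAux A (H (s + θ * I)).re (G (s + θ * I)).im
  let P₁ : ℝ → ℝ → ℝ := fun s θ => zygmundAuxDeriv A (H (s + θ * I)).re
    (deriv H (s + θ * I)).re (G (s + θ * I)).im (deriv G (s + θ * I)).im
  let P₁₁ : ℝ → ℝ → ℝ := fun s θ => zygmundAuxDeriv₂ A (H (s + θ * I)).re
    (deriv H (s + θ * I)).re (deriv (deriv H) (s + θ * I)).re (G (s + θ * I)).im
    (deriv G (s + θ * I)).im (deriv (deriv G) (s + θ * I)).im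
  let Q₁ : ℝ → ℝ → ℝ := fun s θ => zygmundAuxDeriv A (H (s + θ * I)).re
    (-(deriv H (s + θ * I)).im) (G (s + θ * I)).im (deriv G (s + θ * I)).re
  let Q₁₁ : ℝ → ℝ → ℝ := fun s θ => zygmundAuxDeriv₂ A (H (s + θ * I)).re
    (-(deriv H (s + θ * I)).im) (-(deriv (deriv H) (s + θ * I)).re) (G (s + θ * I)).im
    (deriv G (s + θ * I)).re (-(deriv (deriv G) (s + θ * I)).im)
  have cP : ContinuousOn (fun p : ℝ × ℝ => P p.1 p.2) {p | p.1 < 0} :=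
    (((contre hH).mul hlog).const_mul A).sub hsq
  have cP₁ : ContinuousOn (fun p : ℝ × ℝ => P₁ p.1 p.2) {p | p.1 < 0} :=
    (((contre hH1).mul (hlog.add continuousOn_const)).const_mul A).sub
      ((((contre hH).mul (contre hH1)).add ((contim hG).mul (contim hG1))).div hsq hsq0)
  have cD₂ {x₁ x₂ y₁ y₂ : ℝ × ℝ → ℝ} (h1 : ContinuousOn x₁ {p | p.1 < 0})
      (h2 : ContinuousOn x₂ {p | p.1 < 0}) (h3 : ContinuousOn y₁ {p | p.1 < 0})
      (h4 : ContinuousOn y₂ {p | p.1 < 0}) : ContinuousOn (fun p : ℝ × ℝ =>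
        zygmundAuxDeriv₂ A (H (p.1 + p.2 * I)).re (x₁ p) (x₂ p) (G (p.1 + p.2 * I)).im
          (y₁ p) (y₂ p)) {p | p.1 < 0} := by
    refine (((h2.mul (hlog.add continuousOn_const)).add ((h1.pow 2).div (contre hH) hx0)).const_mul
      A).sub (ContinuousOn.sub (((((h1.pow 2).add (h3.pow 2)).add ((contre hH).mul h2)).add
        ((contim hG).mul h4)).div hsq hsq0) ?_)
    exact ((((contre hH).mul h1).add ((contim hG).mul h3)).pow 2).div (hsq.pow 3)
      fun p hp => pow_ne_zero 3 (hsq0 p hp)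
  have cP₁₁ : ContinuousOn (fun p : ℝ × ℝ => P₁₁ p.1 p.2) {p | p.1 < 0} :=
    cD₂ (contre hH1) (contre hH2) (contim hG1) (contim hG2)
  have cQ₁₁ : ContinuousOn (fun p : ℝ × ℝ => Q₁₁ p.1 p.2) {p | p.1 < 0} :=
    cD₂ (contim hH1).neg (contre hH2).neg (contre hG1) (contim hG2).neg
  have hpos (s θ : ℝ) (hs : s < 0) : 0 < (H (s + θ * I)).re := hH0 _ (by simpa using hs)
  have dP (s : ℝ) (hs : s < 0) (θ : ℝ) : HasDerivAt (fun x => P x θ) (P₁ s θ) s :=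
    hasDerivAt_zygmundAux (cre (horiz hH s θ hs)) (cim (horiz hG s θ hs)) (hpos s θ hs)
  have dP₁ (s : ℝ) (hs : s < 0) (θ : ℝ) : HasDerivAt (fun x => P₁ x θ) (P₁₁ s θ) s :=
    hasDerivAt_zygmundAuxDeriv (x := fun x : ℝ => (H (x + θ * I)).re)
      (y := fun x : ℝ => (G (x + θ * I)).im) (x₁ := fun x : ℝ => (deriv H (x + θ * I)).re)
      (y₁ := fun x : ℝ => (deriv G (x + θ * I)).im)
      (cre (horiz hH s θ hs)) (cim (horiz hG s θ hs)) (cre (horiz hH1 s θ hs))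
      (cim (horiz hG1 s θ hs)) (hpos s θ hs)
  have dQ₁ (s : ℝ) (hs : s < 0) (θ : ℝ) : HasDerivAt (fun x => Q₁ s x) (Q₁₁ s θ) θ :=
    hasDerivAt_zygmundAuxDeriv (x := fun x : ℝ => (H (s + x * I)).re)
      (y := fun x : ℝ => (G (s + x * I)).im) (x₁ := fun x : ℝ => -(deriv H (s + x * I)).im)
      (y₁ := fun x : ℝ => (deriv G (s + x * I)).re)
      (by simpa using cre (vert hH s θ hs)) (by simpa using cim (vert hG s θ hs))
      (by simpa using (cim (vert hH1 s θ hs)).fun_neg)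
      (by simpa using cre (vert hG1 s θ hs)) (hpos s θ hs)
  have perd {E : ℂ → ℂ} (hE : ∀ w, E (w + 2 * π * I) = E w) (w : ℂ) :
      deriv E (w + 2 * π * I) = deriv E w := by
    rw [← deriv_comp_add_const, funext hE]
  have hQ0 (s : ℝ) (hs : s < 0) : ∫ θ in (0 : ℝ)..2 * π, Q₁₁ s θ = 0 := by
    rw [intervalIntegral.integral_eq_sub_of_hasDerivAt (fun θ _ => dQ₁ s hs θ)
      ((slice cQ₁₁ s hs).intervalIntegrable _ _)]
    have e : ((s : ℂ) + ((2 * π : ℝ) : ℂ) * I) = (s + ((0 : ℝ) : ℂ) * I) + 2 * π * I := by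
      push_cast; ring
    simp only [Q₁, e, hHper, hGper, perd hHper, perd hGper, sub_self]
  let m : ℝ → ℝ := fun s => ∫ θ in (0 : ℝ)..2 * π, P s θ
  let N : ℝ → ℝ := fun s => ∫ θ in (0 : ℝ)..2 * π, P₁ s θ
  have dm (s : ℝ) (hs : s < 0) : HasDerivAt m (N s) s :=
    hasDerivAt_integral_of_continuousOn Real.two_pi_pos.le (slice cP) cP₁ dP hs
  have dN (s : ℝ) (hs : s < 0) : HasDerivAt N (∫ θ in (0 : ℝ)..2 * π, P₁₁ s θ) s :=
    hasDerivAt_integral_of_continuousOn Real.two_pi_pos.le (slice cP₁) cP₁₁ dP₁ hs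
  have hN2 (s : ℝ) (hs : s < 0) : 0 ≤ ∫ θ in (0 : ℝ)..2 * π, P₁₁ s θ := by
    have hadd := intervalIntegral.integral_add
      ((slice cP₁₁ s hs).intervalIntegrable (μ := MeasureTheory.volume) 0 (2 * π))
      ((slice cQ₁₁ s hs).intervalIntegrable 0 (2 * π))
    rw [hQ0 s hs, add_zero] at hadd
    rw [← hadd]
    refine intervalIntegral.integral_nonneg Real.two_pi_pos.le fun θ _ => ?_
    refine zygmundAuxDeriv₂_add_nonneg (hpos s θ hs) ?_
    have := pow_le_pow_left₀ (norm_nonneg _) (hGH (s + θ * I) (by simpa using hs)) 2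
    rw [mul_pow, Complex.sq_norm, Complex.sq_norm, Complex.normSq_apply,
      Complex.normSq_apply] at this
    linarith
  have mN : MonotoneOn N (Iio 0) := by
    refine monotoneOn_of_deriv_nonneg (convex_Iio 0)
      (fun s hs => (dN s hs).continuousAt.continuousWithinAt)
      (fun s hs => (dN s (mem_Iio.1 (interior_subset hs))).differentiableAt.differentiableWithinAt)
      fun s hs => ?_
    have hs' := mem_Iio.1 (interior_subset hs)
    rw [(dN s hs').deriv]
    exact hN2 s hs'
  have dq (s : ℝ) (hs : s < 0) : HasDerivAt (fun s => m s - N (-1) * s) (N s - N (-1)) s := by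
    simpa using (dm s hs).fun_sub ((hasDerivAt_id s).const_mul (N (-1)))
  have mq : MonotoneOn (fun s => m s - N (-1) * s) (Ico (-1) 0) := by
    refine monotoneOn_of_deriv_nonneg (convex_Ico _ _)
      (fun s hs => (dq s hs.2).continuousAt.continuousWithinAt)
      (fun s hs => (dq s (interior_subset hs).2).differentiableAt.differentiableWithinAt)
      fun s hs => ?_
    have hs' := interior_subset hs
    rw [(dq s hs'.2).deriv, sub_nonneg]
    exact mN (by norm_num : (-1 : ℝ) < 0) hs'.2 hs'.1
  refine ⟨m (-1) - |N (-1)|, fun s hs1 hs0 => ?_⟩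
  have h1 := mq ⟨le_rfl, by norm_num⟩ ⟨hs1, hs0⟩ hs1
  have h2 : -|N (-1)| ≤ N (-1) * (s + 1) := by
    have : |N (-1) * (s + 1)| ≤ |N (-1)| := by
      rw [abs_mul]
      exact mul_le_of_le_one_right (abs_nonneg _) (abs_le.2 ⟨by linarith, by linarith⟩)
    linarith [neg_abs_le (N (-1) * (s + 1))]
  change m (-1) - |N (-1)| ≤ m s
  simp only at h1
  linarith

theorem mul_log_le_logPlus {x t d : ℝ} (hx : 1 ≤ x) (hd : 2 ≤ d) (h : x ≤ |t| + d) :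
    x * Real.log x ≤ (2 * d) ^ 2 + 4 * (|t| * logPlus |t|) := by
  have hl : 0 ≤ logPlus |t| := le_max_right _ _
  have hlogx : Real.log x ≤ x := (Real.log_le_sub_one_of_pos (by linarith)).trans (by linarith)
  rcases le_total |t| d with h1 | h1
  · have : x * Real.log x ≤ (2 * d) ^ 2 := by
      rw [sq]
      exact mul_le_mul (by linarith) (by linarith) (Real.log_nonneg hx) (by linarith)
    have := mul_nonneg (abs_nonneg t) hl
    linarith
  · have h2 : Real.log x ≤ 2 * logPlus |t| := by
      have h3 : Real.log x ≤ Real.log (|t| * |t|) :=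
        Real.log_le_log (by linarith) (by nlinarith)
      rw [Real.log_mul (by linarith) (by linarith)] at h3
      have : Real.log |t| ≤ logPlus |t| := le_max_left _ _
      linarith
    have : x * Real.log x ≤ (2 * |t|) * (2 * logPlus |t|) :=
      mul_le_mul (by linarith) h2 (Real.log_nonneg hx) (by positivity)
    nlinarith [sq_nonneg d]

theorem continuous_abs_mul_logPlus : Continuous fun t : ℝ => |t| * logPlus |t| := by
  have : (fun t : ℝ => |t| * logPlus |t|) = fun t => max (|t| * Real.log |t|) 0 := by
    funext t
    rw [logPlus, mul_max_of_nonneg _ _ (abs_nonneg t), mul_zero]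
  rw [this]
  exact (Real.continuous_mul_log.comp continuous_abs).max continuous_const

theorem norm_sub_le_mul_norm_add {K : ℝ} (hK : 1 ≤ K) {a b : ℂ}
    (h : ‖b‖ ≤ (K - 1) / (K + 1) * ‖a‖) : ‖a - b‖ ≤ K * ‖a + b‖ := by
  have h1 : ‖a - b‖ ≤ ‖a‖ + ‖b‖ := norm_sub_le _ _
  have h2 : ‖a‖ - ‖b‖ ≤ ‖a + b‖ := by simpa using norm_sub_norm_le a (-b)
  rw [div_mul_eq_mul_div, le_div_iff₀ (by linarith)] at h
  nlinarith

theorem inHardy_one_of_integral_le {f : ℂ → ℂ} {B : ℝ}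
    (h : ∀ r : ℝ, 0 < r → r < 1 →
      ∫ θ in (0 : ℝ)..2 * π, ‖f (r * Complex.exp (θ * I))‖ ≤ B) : InHardy 1 f := by
  refine ⟨1 / (2 * π) * B, fun r hr hr1 => ?_⟩
  simp only [circleMean, Real.rpow_one, div_one]
  exact mul_le_mul_of_nonneg_left (h r hr hr1) (by positivity)

/-- Zygmund's theorem for harmonic `K`-quasiregular mappings with `u` bounded below. -/
theorem zygmund_quasiregular_bddBelow (K : ℝ) (hK : 1 ≤ K) (h g f : ℂ → ℂ)
    (u v : ℂ → ℝ) (C : ℝ)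
    (hh : DifferentiableOn ℂ h unitDisk) (hg : DifferentiableOn ℂ g unitDisk)
    (hg0 : g 0 = 0)
    (hf : ∀ z ∈ unitDisk, f z = h z + (starRingEnd ℂ) (g z))
    (hqr : ∀ z ∈ unitDisk,
      deriv h z ≠ 0 ∧ ‖deriv g z‖ ≤ (K - 1) / (K + 1) * ‖deriv h z‖)
    (hu : ∀ z, u z = (f z).re) (hv : ∀ z, v z = (f z).im)
    (huC : ∀ z ∈ unitDisk, C ≤ u z) (hv0 : v 0 = 0)
    (huZ : InZygmundClass u) :
    InHardy 1 f := by
  have hopen : IsOpen unitDisk := Metric.isOpen_ball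
  have hexp (w : ℂ) (hw : w.re < 0) : Complex.exp w ∈ unitDisk := by
    simpa [unitDisk, Complex.norm_exp] using hw
  have hmem (r θ : ℝ) (hr : 0 < r) (hr1 : r < 1) :
      (r : ℂ) * Complex.exp (θ * I) ∈ unitDisk := by
    simpa [unitDisk, Complex.norm_exp, abs_of_pos hr] using hr1
  have hfc : ContinuousOn f unitDisk :=
    (hh.continuousOn.add (Complex.continuous_conj.comp_continuousOn hg.continuousOn)).congr hf
  have hfr (r : ℝ) (hr : 0 < r) (hr1 : r < 1) :
      Continuous fun θ : ℝ => f (r * Complex.exp (θ * I)) :=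
    hfc.comp_continuous (by fun_prop) fun θ => hmem r θ hr hr1
  let H : ℂ → ℂ := fun w => h (Complex.exp w) + g (Complex.exp w) - (C - 1 : ℝ)
  let G : ℂ → ℂ := fun w => h (Complex.exp w) - g (Complex.exp w)
  have hHre (w : ℂ) (hw : w.re < 0) : (H w).re = u (Complex.exp w) - (C - 1) := by
    simp [H, hu, hf _ (hexp w hw)]
  have hGim (w : ℂ) (hw : w.re < 0) : (G w).im = v (Complex.exp w) := by
    simp [G, hv, hf _ (hexp w hw), sub_eq_add_neg]
  have dH (w : ℂ) (hw : w.re < 0) : HasDerivAt H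
      ((deriv h (Complex.exp w) + deriv g (Complex.exp w)) * Complex.exp w) w := by
    have h1 := ((hh.differentiableAt (hopen.mem_nhds (hexp w hw))).hasDerivAt).comp w
      (Complex.hasDerivAt_exp w)
    have h2 := ((hg.differentiableAt (hopen.mem_nhds (hexp w hw))).hasDerivAt).comp w
      (Complex.hasDerivAt_exp w)
    exact ((h1.add h2).sub_const _).congr_deriv (by ring)
  have dG (w : ℂ) (hw : w.re < 0) : HasDerivAt G
      ((deriv h (Complex.exp w) - deriv g (Complex.exp w)) * Complex.exp w) w := by
    have h1 := ((hh.differentiableAt (hopen.mem_nhds (hexp w hw))).hasDerivAt).comp w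
      (Complex.hasDerivAt_exp w)
    have h2 := ((hg.differentiableAt (hopen.mem_nhds (hexp w hw))).hasDerivAt).comp w
      (Complex.hasDerivAt_exp w)
    exact (h1.sub h2).congr_deriv (by ring)
  have hH1 (w : ℂ) (hw : w.re < 0) : 1 ≤ (H w).re := by
    rw [hHre w hw]
    linarith [huC _ (hexp w hw)]
  have hper (w : ℂ) : Complex.exp (w + 2 * π * I) = Complex.exp w := Complex.exp_periodic w
  obtain ⟨B, hB⟩ := exists_le_integral_zygmundAux (K := K) (H := H) (G := G)
    (fun w hw => (dH w hw).differentiableAt.differentiableWithinAt)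
    (fun w hw => (dG w hw).differentiableAt.differentiableWithinAt)
    (fun w => by simp only [H, hper]) (fun w => by simp only [G, hper])
    (fun w hw => zero_lt_one.trans_le (hH1 w hw))
    (fun w hw => by
      rw [(dH w hw).deriv, (dG w hw).deriv, norm_mul, norm_mul, ← mul_assoc]
      exact mul_le_mul_of_nonneg_right (norm_sub_le_mul_norm_add hK (hqr _ (hexp w hw)).2)
        (norm_nonneg _))
  obtain ⟨Z, hZ⟩ := huZ
  obtain ⟨M, hM⟩ := (isCompact_closedBall (0 : ℂ) (Real.exp (-1))).exists_bound_of_continuousOn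
    (hfc.mono (Metric.closedBall_subset_ball (by simp)))
  let d : ℝ := |C| + 2
  let A : ℝ := 1 + K ^ 2
  have hA : 0 ≤ A := by positivity
  refine inHardy_one_of_integral_le
    (B := max (2 * π * M) (A * (2 * π * (2 * d) ^ 2 + 4 * Z) + 2 * π * d - B)) fun r hr hr1 => ?_
  have hfi : IntervalIntegrable (fun θ : ℝ => ‖f (r * Complex.exp (θ * I))‖)
    MeasureTheory.volume 0 (2 * π) := (hfr r hr hr1).norm.intervalIntegrable _ _
  rcases le_total r (Real.exp (-1)) with hre | hre
  · refine le_max_of_le_left ?_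
    calc ∫ θ in (0 : ℝ)..2 * π, ‖f (r * Complex.exp (θ * I))‖
        ≤ ∫ _θ in (0 : ℝ)..2 * π, M := by
          refine intervalIntegral.integral_mono_on Real.two_pi_pos.le hfi
            intervalIntegrable_const fun θ _ => hM _ ?_
          simpa [Complex.norm_exp, abs_of_pos hr] using hre
      _ = 2 * π * M := by simp
  · refine le_max_of_le_right ?_
    set s := Real.log r with hs
    have hs0 : s < 0 := Real.log_neg hr hr1
    have hs1 : -1 ≤ s := (Real.le_log_iff_exp_le hr).2 hre
    have hpt (θ : ℝ) : Complex.exp (s + θ * I) = r * Complex.exp (θ * I) := by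
      rw [Complex.exp_add, ← Complex.ofReal_exp, hs, Real.exp_log hr]
    have hwre (θ : ℝ) : ((s : ℂ) + θ * I).re < 0 := by simpa using hs0
    have hu' : Continuous fun θ : ℝ => u (r * Complex.exp (θ * I)) := by
      simp only [hu]
      exact Complex.continuous_re.comp (hfr r hr hr1)
    have hv' : Continuous fun θ : ℝ => v (r * Complex.exp (θ * I)) := by
      simp only [hv]
      exact Complex.continuous_im.comp (hfr r hr hr1)
    have hcH : Continuous fun θ : ℝ => (H (s + θ * I)).re := by
      simp only [hHre _ (hwre _), hpt]
      exact hu'.sub continuous_const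
    have hcG : Continuous fun θ : ℝ => (G (s + θ * I)).im := by
      simp only [hGim _ (hwre _), hpt]
      exact hv'
    have hcaux : Continuous fun θ : ℝ =>
        zygmundAux A (H (s + θ * I)).re (G (s + θ * I)).im :=
      ((Real.continuous_mul_log.comp hcH).const_mul A).sub
        ((hcH.pow 2).add (hcG.pow 2)).sqrt
    have hcu : Continuous fun θ : ℝ => |u (r * Complex.exp (θ * I))| *
        logPlus |u (r * Complex.exp (θ * I))| := continuous_abs_mul_logPlus.comp hu'
    have hbound (θ : ℝ) : ‖f (r * Complex.exp (θ * I))‖ ≤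
        A * ((2 * d) ^ 2 + 4 * (|u (r * Complex.exp (θ * I))| *
          logPlus |u (r * Complex.exp (θ * I))|)) + d
          - zygmundAux A (H (s + θ * I)).re (G (s + θ * I)).im := by
      have hxe := hHre _ (hwre θ)
      have hye := hGim _ (hwre θ)
      have hx1 := hH1 _ (hwre θ)
      rw [hpt] at hxe hye
      set z := (r : ℂ) * Complex.exp (θ * I)
      set x := (H (s + θ * I)).re
      set y := (G (s + θ * I)).im
      have hC1 : |C - 1| ≤ |C| + 1 := by simpa using abs_sub C 1
      have h1 : x * Real.log x ≤ (2 * d) ^ 2 + 4 * (|u z| * logPlus |u z|) :=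
        mul_log_le_logPlus hx1 (by simp [d]) (by
          simp only [d]
          linarith [le_abs_self (u z), neg_abs_le (C - 1)])
      have h2 : ‖f z‖ ≤ √(x ^ 2 + y ^ 2) + d := by
        have e : f z = (⟨x, y⟩ : ℂ) + ((C - 1 : ℝ) : ℂ) := by
          apply Complex.ext
          · simp [hxe, hu]
          · simp [hye, hv]
        have e2 : ‖(⟨x, y⟩ : ℂ)‖ = √(x ^ 2 + y ^ 2) := by
          rw [Complex.norm_def, Complex.normSq_mk, sq, sq]
        rw [e]
        refine (norm_add_le _ _).trans ?_
        rw [e2, Complex.norm_real, Real.norm_eq_abs]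
        simp only [d]
        linarith
      have h3 := mul_le_mul_of_nonneg_left h1 hA
      unfold zygmundAux
      linarith
    have hcm : Continuous fun θ : ℝ => A * ((2 * d) ^ 2 + 4 * (|u (r * Complex.exp (θ * I))| *
          logPlus |u (r * Complex.exp (θ * I))|)) + d := by fun_prop
    have hint : ∫ θ in (0 : ℝ)..2 * π, (A * ((2 * d) ^ 2 + 4 * (|u (r * Complex.exp (θ * I))| *
          logPlus |u (r * Complex.exp (θ * I))|)) + d)
        = A * (2 * π * (2 * d) ^ 2 + 4 * zygmundIntegral u r) + 2 * π * d := by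
      rw [intervalIntegral.integral_add (Continuous.intervalIntegrable (by fun_prop) _ _)
          intervalIntegrable_const, intervalIntegral.integral_const_mul,
        intervalIntegral.integral_add intervalIntegrable_const
          (Continuous.intervalIntegrable (by fun_prop) _ _), intervalIntegral.integral_const_mul]
      simp [zygmundIntegral]
    have hmono := intervalIntegral.integral_mono_on Real.two_pi_pos.le hfi
      ((hcm.fun_sub hcaux).intervalIntegrable _ _) fun θ _ => hbound θ
    rw [intervalIntegral.integral_sub (hcm.intervalIntegrable _ _)
      (hcaux.intervalIntegrable _ _), hint] at hmono
    have h4 := mul_le_mul_of_nonneg_left (hZ r hr hr1) hA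
    have h5 := hB s hs1 hs0
    change B ≤ ∫ θ in (0 : ℝ)..2 * π, zygmundAux A (H (s + θ * I)).re (G (s + θ * I)).im at h5
    linarith
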